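/- arXiv:1909.05951 — 4 statements merged into one kernel-verified Lean document; each statement's English description precedes it below -/
import Mathlib

section
/- Let G(V, →) be a directed graph and let W(V, X, ⇀, ▷) be a weak partial order (WPO) for G. Define B_W := {(u, v) | u → v and there exists x ∈ X with u ∈ ⟦v, x⟧_{⇀*} and x ▷ v}. Then B_W is a feedback edge set for G: every cycle of G (a sequence of distinct vertices v₁ → v₂ → … → vₙ → v₁) contains at least one edge belonging to B_W; equivalently, the reflexive transitive closure of → \ B_W is antisymmetric, so the graph (V, → \ B_W) is acyclic. -/
open Relation Set

/-- The component `⟦u, v⟧` with respect to the reflexive transitive closure of `sched`: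
the set of `w` with `u ⇀* w` and `w ⇀* v`. -/
def wpoComp {α : Type*} (sched : α → α → Prop) (u v : α) : Set α :=
  {w | Relation.ReflTransGen sched u w ∧ Relation.ReflTransGen sched w v}

/-- Restriction of a binary relation to a set: `R ∩ (S × S)`. -/
def restrictRel {α : Type*} (r : α → α → Prop) (S : Set α) : α → α → Prop :=
  fun u v => r u v ∧ u ∈ S ∧ v ∈ S

/-- `(V, X, sched, stab)` is a weak partial order (WPO) for the directed graph `(V, edge)`. -/
structure IsWPO {α : Type*} (V X : Set α) (edge sched stab : α → α → Prop) : Prop where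
  /-- `edge` is a binary relation on the vertex set `V`. -/
  edge_mem : ∀ ⦃u v⦄, edge u v → u ∈ V ∧ v ∈ V
  /-- (W1) `V ∩ X = ∅`. -/
  W1 : V ∩ X = ∅
  /-- (W2) `stab ⊆ X × V`. -/
  W2 : ∀ ⦃x v⦄, stab x v → x ∈ X ∧ v ∈ V
  /-- (W2) every exit has a stabilization target. -/
  W2' : ∀ x ∈ X, ∃ v ∈ V, stab x v
  /-- (W3) `sched ⊆ (V ∪ X) × (V ∪ X)`. -/
  W3 : ∀ ⦃u v⦄, sched u v → u ∈ V ∪ X ∧ v ∈ V ∪ X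
  /-- (H1) `sched*` is antisymmetric, i.e. a partial order on `V ∪ X`. -/
  H1 : ∀ ⦃u v⦄, Relation.ReflTransGen sched u v → Relation.ReflTransGen sched v u → u = v
  /-- (H2) `stab` is one-to-one (injective). -/
  H2_left : ∀ ⦃x y v⦄, stab x v → stab y v → x = y
  /-- (H2) `stab` is one-to-one (functional). -/
  H2_right : ∀ ⦃x u v⦄, stab x u → stab x v → u = v
  /-- (H3) `x ▷ h` implies `h ⇀* x` and `h ≠ x`. -/
  H3 : ∀ ⦃x h⦄, stab x h → Relation.ReflTransGen sched h x ∧ h ≠ x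
  /-- (H4) components are well-nested. -/
  H4 : ∀ ⦃h₁ x₁ h₂ x₂⦄, stab x₁ h₁ → stab x₂ h₂ →
      wpoComp sched h₁ x₁ ∩ wpoComp sched h₂ x₂ = ∅ ∨
      wpoComp sched h₁ x₁ ⊆ wpoComp sched h₂ x₂ ∨
      wpoComp sched h₂ x₂ ⊆ wpoComp sched h₁ x₁
  /-- (H5) values do not leak out of a component except via its exit. -/
  H5 : ∀ ⦃h x u v⦄, stab x h → Relation.ReflTransGen sched h u →
      Relation.ReflTransGen sched u x → Relation.ReflTransGen sched u v →
      Relation.TransGen sched x v ∨ Relation.ReflTransGen sched v x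
  /-- (W5) every graph edge is captured by the WPO. -/
  W5 : ∀ ⦃u v⦄, edge u v →
      Relation.TransGen sched u v ∨ ∃ x ∈ X, u ∈ wpoComp sched v x ∧ stab x v

/-- The back edges of `G` with respect to the WPO. -/
def wpoBackEdges {α : Type*} (X : Set α) (edge sched stab : α → α → Prop) :
    α → α → Prop :=
  fun u v => edge u v ∧ ∃ x ∈ X, u ∈ wpoComp sched v x ∧ stab x v

/-- Theorem: `B_W` is a feedback edge set for `G`, i.e. the reflexive transitive closure of
`→ \ B_W` is antisymmetric (the graph `(V, → \ B_W)` is acyclic). -/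
theorem wpo_backEdges_feedback {α : Type*} (V X : Set α) (edge sched stab : α → α → Prop)
    (hW : IsWPO V X edge sched stab) :
    ∀ u v,
      Relation.ReflTransGen (fun a b => edge a b ∧ ¬ wpoBackEdges X edge sched stab a b) u v →
      Relation.ReflTransGen (fun a b => edge a b ∧ ¬ wpoBackEdges X edge sched stab a b) v u →
      u = v := by
  have sched_of_path : ∀ {a b},
      Relation.ReflTransGen (fun a b => edge a b ∧ ¬ wpoBackEdges X edge sched stab a b) a b →
      Relation.ReflTransGen sched a b := by
    intro a b hab
    induction hab with
    | refl => exact .refl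
    | tail _ hstep ih =>
      obtain ⟨hedge, hback⟩ := hstep
      rcases hW.W5 hedge with h | h
      · exact ih.trans h.to_reflTransGen
      · exact absurd ⟨hedge, h⟩ hback
  intro u v huv hvu
  exact hW.H1 (sched_of_path huv) (sched_of_path hvu)
end

section
/- Let G(V, →) be a directed graph and let W(V, X, ⇀, ▷) be a weak partial order (WPO) for G. Let C = ⟦h, x⟧_{⇀*} be any component of W (i.e., x ▷ h). Then the restriction W_{↾C} = (V ∩ C, X ∩ C, ⇀_{↾C}, ▷_{↾C}) is a weak partial order for the induced subgraph G_{↾C} = (V ∩ C, →_{↾C}). -/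
open Relation Set

section Restriction

variable {α : Type*} {r : α → α → Prop} {S : Set α} {h x a b : α}

theorem restrictRel_reflTransGen (hab : ReflTransGen (restrictRel r S) a b) :
    ReflTransGen r a b :=
  ReflTransGen.mono (fun _ _ hr => hr.1) _ _ hab

theorem reflTransGen_restrictRel_mem (hab : ReflTransGen (restrictRel r S) a b)
    (ha : a ∈ S) : b ∈ S := by
  induction hab with
  | refl => exact ha
  | tail _ hbc _ => exact hbc.2.2

theorem transGen_restrictRel_wpoComp (hab : TransGen r a b) (ha : a ∈ wpoComp r h x)
    (hb : b ∈ wpoComp r h x) : TransGen (restrictRel r (wpoComp r h x)) a b := by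
  induction hab with
  | single hab => exact .single ⟨hab, ha, hb⟩
  | @tail c d hac hcd ih =>
    have hc : c ∈ wpoComp r h x := ⟨ha.1.trans hac.to_reflTransGen, hb.2.head hcd⟩
    exact (ih hc).tail ⟨hcd, hc, hb⟩

theorem reflTransGen_restrictRel_wpoComp (hab : ReflTransGen r a b)
    (ha : a ∈ wpoComp r h x) (hb : b ∈ wpoComp r h x) :
    ReflTransGen (restrictRel r (wpoComp r h x)) a b := by
  rcases reflTransGen_iff_eq_or_transGen.1 hab with rfl | hab
  · exact .refl
  · exact (transGen_restrictRel_wpoComp hab ha hb).to_reflTransGen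

theorem wpoComp_restrictRel_wpoComp (ha : a ∈ wpoComp r h x) (hb : b ∈ wpoComp r h x) :
    wpoComp (restrictRel r (wpoComp r h x)) a b = wpoComp r a b := by
  ext w
  refine ⟨fun hw => ⟨restrictRel_reflTransGen hw.1, restrictRel_reflTransGen hw.2⟩,
    fun hw => ?_⟩
  have hwC : w ∈ wpoComp r h x := ⟨ha.1.trans hw.1, hw.2.trans hb.2⟩
  exact ⟨reflTransGen_restrictRel_wpoComp hw.1 ha hwC,
    reflTransGen_restrictRel_wpoComp hw.2 hwC hb⟩

end Restriction

namespace IsWPO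

variable {α : Type*} {V X : Set α} {edge sched stab : α → α → Prop} {h x k y : α}

/-- A component containing the exit of another component also contains its head. -/
theorem head_mem_of_exit_mem (hW : IsWPO V X edge sched stab) (hx : stab x h)
    (hy : stab y k) (hyC : y ∈ wpoComp sched h x) : k ∈ wpoComp sched h x := by
  have hky := (hW.H3 hy).1
  have hhx := (hW.H3 hx).1
  rcases hW.H4 hy hx with hd | hs | hs
  · exact absurd (hd ▸ ⟨⟨hky, .refl⟩, hyC⟩ : y ∈ (∅ : Set α)) (notMem_empty y)
  · exact hs ⟨.refl, hky⟩
  · obtain rfl : y = x := hW.H1 hyC.2 (hs ⟨hhx, .refl⟩).2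
    obtain rfl : k = h := hW.H2_right hy hx
    exact ⟨.refl, hhx⟩

/-- A component containing the head of another component also contains its exit. -/
theorem exit_mem_of_head_mem (hW : IsWPO V X edge sched stab) (hx : stab x h)
    (hy : stab y k) (hkC : k ∈ wpoComp sched h x) : y ∈ wpoComp sched h x := by
  have hky := (hW.H3 hy).1
  have hhx := (hW.H3 hx).1
  rcases hW.H4 hy hx with hd | hs | hs
  · exact absurd (hd ▸ ⟨⟨.refl, hky⟩, hkC⟩ : k ∈ (∅ : Set α)) (notMem_empty k)
  · exact hs ⟨hky, .refl⟩
  · obtain rfl : k = h := hW.H1 (hs ⟨.refl, hhx⟩).1 hkC.1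
    obtain rfl : y = x := hW.H2_left hy hx
    exact ⟨hhx, .refl⟩

end IsWPO

/-- Theorem: the restriction of a WPO to one of its components `C = ⟦h, x⟧` is a WPO
for the induced subgraph `G_{↾C}`. -/
theorem wpo_restrict_component {α : Type*} (V X : Set α) (edge sched stab : α → α → Prop)
    (hW : IsWPO V X edge sched stab) {h x : α} (hx : stab x h) :
    IsWPO (V ∩ wpoComp sched h x) (X ∩ wpoComp sched h x)
      (restrictRel edge (wpoComp sched h x))
      (restrictRel sched (wpoComp sched h x))
      (restrictRel stab (wpoComp sched h x)) := by
  refine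
    { edge_mem := fun u v ⟨e, hu, hv⟩ =>
        ⟨⟨(hW.edge_mem e).1, hu⟩, ⟨(hW.edge_mem e).2, hv⟩⟩
      W1 := by rw [← inter_inter_distrib_right, hW.W1, empty_inter]
      W2 := fun y v ⟨s, hy, hv⟩ => ⟨⟨(hW.W2 s).1, hy⟩, ⟨(hW.W2 s).2, hv⟩⟩
      W2' := ?_
      W3 := fun u v ⟨s, hu, hv⟩ => by
        rw [← union_inter_distrib_right]
        exact ⟨⟨(hW.W3 s).1, hu⟩, ⟨(hW.W3 s).2, hv⟩⟩
      H1 := fun u v huv hvu =>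
        hW.H1 (restrictRel_reflTransGen huv) (restrictRel_reflTransGen hvu)
      H2_left := fun _ _ _ s t => hW.H2_left s.1 t.1
      H2_right := fun _ _ _ s t => hW.H2_right s.1 t.1
      H3 := fun y k ⟨s, hy, hk⟩ =>
        ⟨reflTransGen_restrictRel_wpoComp (hW.H3 s).1 hk hy, (hW.H3 s).2⟩
      H4 := fun h₁ x₁ h₂ x₂ ⟨s, hx₁, hh₁⟩ ⟨t, hx₂, hh₂⟩ => by
        rw [wpoComp_restrictRel_wpoComp hh₁ hx₁, wpoComp_restrictRel_wpoComp hh₂ hx₂]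
        exact hW.H4 s t
      H5 := ?_
      W5 := ?_ }
  · rintro y ⟨hyX, hyC⟩
    obtain ⟨v, hv, s⟩ := hW.W2' y hyX
    have hvC := hW.head_mem_of_exit_mem hx s hyC
    exact ⟨v, ⟨hv, hvC⟩, s, hyC, hvC⟩
  · rintro k y u v ⟨s, hy, hk⟩ hku huy huv
    have hv := reflTransGen_restrictRel_mem (hku.trans huv) hk
    exact (hW.H5 s (restrictRel_reflTransGen hku) (restrictRel_reflTransGen huy)
      (restrictRel_reflTransGen huv)).imp
        (fun hyv => transGen_restrictRel_wpoComp hyv hy hv)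
        (fun hvy => reflTransGen_restrictRel_wpoComp hvy hv hy)
  · rintro u v ⟨e, hu, hv⟩
    rcases hW.W5 e with huv | ⟨y, hyX, huy, s⟩
    · exact .inl (transGen_restrictRel_wpoComp huv hu hv)
    · have hy := hW.exit_mem_of_head_mem hx s hv
      exact .inr ⟨y, ⟨hyX, hy⟩, (wpoComp_restrictRel_wpoComp hv hy).symm ▸ huy, s, hy, hv⟩
end

section
/- Let G(V, →) be a directed graph and let W(V, X, ⇀, ▷) be a weak partial order (WPO) for G. Suppose V ∪ X = ⟦h, x⟧_{⇀*} for some pair with x ▷ h, and let S := (V ∪ X) \ {h, x}. Then the restriction W_{↾S} = (V ∩ S, X ∩ S, ⇀_{↾S}, ▷_{↾S}) is a weak partial order for the induced subgraph G_{↾S} = (V ∩ S, →_{↾S}). -/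
open Relation Set

theorem reflTransGen_of_restrictRel {α : Type*} {r : α → α → Prop} {S : Set α} {u v : α}
    (huv : ReflTransGen (restrictRel r S) u v) : ReflTransGen r u v :=
  ReflTransGen.mono (fun _ _ hab => hab.1) _ _ huv

theorem mem_of_reflTransGen_restrictRel {α : Type*} {r : α → α → Prop} {S : Set α} {u v : α}
    (huv : ReflTransGen (restrictRel r S) u v) (hu : u ∈ S) : v ∈ S := by
  induction huv with
  | refl => exact hu
  | tail _ hbc _ => exact hbc.2.2

/-- A path between two points of an order-convex set stays inside the set. -/
theorem reflTransGen_restrictRel {α : Type*} {r : α → α → Prop} {S : Set α}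
    (hS : ∀ ⦃u w v⦄, u ∈ S → v ∈ S → ReflTransGen r u w → ReflTransGen r w v → w ∈ S)
    {u v : α} (huv : ReflTransGen r u v) (hu : u ∈ S) (hv : v ∈ S) :
    ReflTransGen (restrictRel r S) u v := by
  induction huv using ReflTransGen.head_induction_on with
  | refl => exact .refl
  | head hac hcv ih =>
    have hc := hS hu hv (.single hac) hcv
    exact .head ⟨hac, hu, hc⟩ (ih hc)

theorem transGen_restrictRel {α : Type*} {r : α → α → Prop} {S : Set α}
    (hS : ∀ ⦃u w v⦄, u ∈ S → v ∈ S → ReflTransGen r u w → ReflTransGen r w v → w ∈ S)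
    {u v : α} (huv : TransGen r u v) (hu : u ∈ S) (hv : v ∈ S) :
    TransGen (restrictRel r S) u v := by
  obtain ⟨c, huc, hcv⟩ := TransGen.head'_iff.1 huv
  have hc := hS hu hv (.single huc) hcv
  exact .head' ⟨huc, hu, hc⟩ (reflTransGen_restrictRel hS hcv hc hv)

theorem wpoComp_restrictRel {α : Type*} {r : α → α → Prop} {S : Set α}
    (hS : ∀ ⦃u w v⦄, u ∈ S → v ∈ S → ReflTransGen r u w → ReflTransGen r w v → w ∈ S)
    {u v : α} (hu : u ∈ S) (hv : v ∈ S) :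
    wpoComp (restrictRel r S) u v = wpoComp r u v := by
  ext w
  refine ⟨fun hw => ⟨reflTransGen_of_restrictRel hw.1, reflTransGen_of_restrictRel hw.2⟩,
    fun hw => ?_⟩
  have hwS := hS hu hv hw.1 hw.2
  exact ⟨reflTransGen_restrictRel hS hw.1 hu hwS, reflTransGen_restrictRel hS hw.2 hwS hv⟩

/-- Removing the head and the exit of a component leaves an order-convex set. -/
theorem mem_wpoComp_diff_of_between {α : Type*} {r : α → α → Prop} {h x : α}
    (hr : ∀ ⦃u v⦄, ReflTransGen r u v → ReflTransGen r v u → u = v) ⦃u w v : α⦄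
    (hu : u ∈ wpoComp r h x \ {h, x}) (hv : v ∈ wpoComp r h x \ {h, x})
    (huw : ReflTransGen r u w) (hwv : ReflTransGen r w v) : w ∈ wpoComp r h x \ {h, x} := by
  refine ⟨⟨hu.1.1.trans huw, hwv.trans hv.1.2⟩, ?_⟩
  rintro (rfl | rfl)
  · exact hu.2 (.inl (hr huw hu.1.1))
  · exact hv.2 (.inr (hr hv.1.2 hwv))

/-- Theorem: if `V ∪ X = ⟦h, x⟧` for some `x ▷ h`, then the restriction of the WPO to
`S = (V ∪ X) \ {h, x}` is a WPO for the induced subgraph `G_{↾S}`. -/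
theorem wpo_restrict_remove_head_exit {α : Type*} (V X : Set α)
    (edge sched stab : α → α → Prop) (hW : IsWPO V X edge sched stab)
    {h x : α} (hx : stab x h) (hall : V ∪ X = wpoComp sched h x) :
    IsWPO (V ∩ ((V ∪ X) \ {h, x})) (X ∩ ((V ∪ X) \ {h, x}))
      (restrictRel edge ((V ∪ X) \ {h, x}))
      (restrictRel sched ((V ∪ X) \ {h, x}))
      (restrictRel stab ((V ∪ X) \ {h, x})) := by
  have hS : ∀ ⦃u w v⦄, u ∈ (V ∪ X) \ {h, x} → v ∈ (V ∪ X) \ {h, x} →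
      ReflTransGen sched u w → ReflTransGen sched w v → w ∈ (V ∪ X) \ {h, x} := by
    rw [hall]
    exact mem_wpoComp_diff_of_between hW.H1
  have hdisj : ∀ ⦃a⦄, a ∈ V → a ∉ X := fun a hV hX => hW.W1.subset ⟨hV, hX⟩
  obtain ⟨hxX, hhV⟩ := hW.W2 hx
  generalize hSdef : (V ∪ X) \ {h, x} = S at hS ⊢
  refine
    { edge_mem := ?_, W1 := ?_, W2 := ?_, W2' := ?_, W3 := ?_, H1 := ?_, H2_left := ?_,
      H2_right := ?_, H3 := ?_, H4 := ?_, H5 := ?_, W5 := ?_ }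
  · rintro u v ⟨huv, hu, hv⟩
    exact ⟨⟨(hW.edge_mem huv).1, hu⟩, (hW.edge_mem huv).2, hv⟩
  · exact eq_empty_of_forall_notMem fun a ha => hdisj ha.1.1 ha.2.1
  · rintro y v ⟨hyv, hy, hv⟩
    exact ⟨⟨(hW.W2 hyv).1, hy⟩, (hW.W2 hyv).2, hv⟩
  · rintro y ⟨hyX, hy⟩
    obtain ⟨v, hvV, hyv⟩ := hW.W2' y hyX
    have hv : v ∈ S := by
      subst hSdef
      refine ⟨.inl hvV, ?_⟩
      rintro (rfl | rfl)
      · exact hy.2 (.inr (hW.H2_left hyv hx))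
      · exact hdisj hvV hxX
    exact ⟨v, ⟨hvV, hv⟩, hyv, hy, hv⟩
  · rintro u v ⟨huv, hu, hv⟩
    rw [← union_inter_distrib_right]
    exact ⟨⟨(hW.W3 huv).1, hu⟩, (hW.W3 huv).2, hv⟩
  · exact fun u v huv hvu =>
      hW.H1 (reflTransGen_of_restrictRel huv) (reflTransGen_of_restrictRel hvu)
  · exact fun _ _ _ h₁ h₂ => hW.H2_left h₁.1 h₂.1
  · exact fun _ _ _ h₁ h₂ => hW.H2_right h₁.1 h₂.1
  · rintro y k ⟨hyk, hy, hk⟩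
    exact ⟨reflTransGen_restrictRel hS (hW.H3 hyk).1 hk hy, (hW.H3 hyk).2⟩
  · rintro h₁ x₁ h₂ x₂ ⟨h₁₁, hx₁, hh₁⟩ ⟨h₂₂, hx₂, hh₂⟩
    rw [wpoComp_restrictRel hS hh₁ hx₁, wpoComp_restrictRel hS hh₂ hx₂]
    exact hW.H4 h₁₁ h₂₂
  · rintro k y u v ⟨hyk, hy, hk⟩ hku huy huv
    have hv := mem_of_reflTransGen_restrictRel (hku.trans huv) hk
    exact (hW.H5 hyk (reflTransGen_of_restrictRel hku) (reflTransGen_of_restrictRel huy)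
      (reflTransGen_of_restrictRel huv)).imp
      (transGen_restrictRel hS · hy hv) (reflTransGen_restrictRel hS · hv hy)
  · rintro u v ⟨huv, hu, hv⟩
    refine (hW.W5 huv).imp (transGen_restrictRel hS · hu hv) ?_
    rintro ⟨y, hyX, huy, hyv⟩
    have hy : y ∈ S := by
      subst hSdef
      refine ⟨.inr hyX, ?_⟩
      rintro (rfl | rfl)
      · exact hdisj hhV hyX
      · exact hv.2 (.inl (hW.H2_right hyv hx))
    refine ⟨y, ⟨hyX, hy⟩, ?_, hyv, hy, hv⟩
    rwa [wpoComp_restrictRel hS hv hy]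
end

section
/- Let G(V, →) be a directed graph and let W(V, X, ⇀, ▷) be a weak partial order (WPO) for G. Then the set of component heads H := {h ∈ V | there exists x ∈ X with x ▷ h} is a feedback vertex set of G: every cycle of G (a sequence of distinct vertices v₁ → v₂ → … → vₙ → v₁) contains a vertex belonging to H; equivalently, the induced subgraph of G on V \ H is acyclic. -/
open Relation Set

/-- Theorem: the set of component heads `H = {h ∈ V | ∃ x ∈ X, x ▷ h}` is a feedback
vertex set of `G`: the induced subgraph of `G` on `V \ H` is acyclic, i.e. the reflexive
transitive closure of the restriction of `→` to `V \ H` is antisymmetric. -/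
theorem wpo_heads_feedback_vertex_set {α : Type*} (V X : Set α)
    (edge sched stab : α → α → Prop) (hW : IsWPO V X edge sched stab) :
    ∀ u v,
      Relation.ReflTransGen (restrictRel edge (V \ {h | ∃ x ∈ X, stab x h})) u v →
      Relation.ReflTransGen (restrictRel edge (V \ {h | ∃ x ∈ X, stab x h})) v u →
      u = v := by
  have sched_of_edge : ∀ a b,
      restrictRel edge (V \ {h | ∃ x ∈ X, stab x h}) a b → ReflTransGen sched a b := by
    rintro a b ⟨hab, -, hb⟩
    rcases hW.W5 hab with h | ⟨x, hx, -, hs⟩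
    · exact h.to_reflTransGen
    · exact absurd ⟨x, hx, hs⟩ hb.2
  intro u v huv hvu
  exact hW.H1 (reflTransGen_closed sched_of_edge _ _ huv) (reflTransGen_closed sched_of_edge _ _ hvu)
end
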